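/- There is a universal constant C > 0 (one may take C = 16/(√3·π)) such that for all x, y ∈ ℝ with 0 ≤ |x| ≤ y, the image of the tip x + iy under the mapping-out function g of the straight segment [0, x+iy] in the upper half-plane satisfies |g(x+iy)| ≤ C·|x|. -/

import Mathlib

open Set Filter Complex

/-- The open upper half-plane, as a subset of `ℂ`. -/
def UHP : Set ℂ := {z : ℂ | 0 < z.im}

/-- `g` is the (hydrodynamically normalized) mapping-out function of the
compact `ℍ`-hull `K`: a conformal bijection from `ℍ ∖ K` onto `ℍ` with
`g(z) − z → 0` as `z → ∞`. -/
def IsMappingOut (K : Set ℂ) (g : ℂ → ℂ) : Prop :=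
  DifferentiableOn ℂ g (UHP \ K) ∧ Set.BijOn g (UHP \ K) UHP ∧
    Tendsto (fun z => g z - z)
      (comap (fun z : ℂ => ‖z‖) atTop ⊓ 𝓟 (UHP \ K)) (nhds 0)

open Topology

theorem isOpen_UHP : IsOpen UHP := isOpen_lt continuous_const Complex.continuous_im

theorem convex_UHP : Convex ℝ UHP := convex_halfSpace_im_gt 0

/-- An injective holomorphic function on the upper half-plane is an open map. -/
theorem isOpen_image_of_injOn {f : ℂ → ℂ} (hf : DifferentiableOn ℂ f UHP) (hi : InjOn f UHP)
    {s : Set ℂ} (hs : s ⊆ UHP) (ho : IsOpen s) : IsOpen (f '' s) := by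
  rcases (hf.analyticOnNhd isOpen_UHP).is_constant_or_isOpen convex_UHP.isPreconnected with
    ⟨c, hc⟩ | h
  · have h1 : I ∈ UHP := by simp [UHP]
    have h2 : 2 * I ∈ UHP := by simp [UHP]
    have h3 := hi h1 h2 ((hc _ h1).trans (hc _ h2).symm)
    have h4 := congrArg Complex.im h3
    norm_num at h4
  · exact h s hs ho

/-- The inverse of an injective holomorphic function on the upper half-plane is holomorphic. -/
theorem differentiableOn_leftInverse {f g : ℂ → ℂ} (hf : DifferentiableOn ℂ f UHP)
    (hg : ∀ z ∈ UHP, g (f z) = z) : DifferentiableOn ℂ g (f '' UHP) := by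
  have hi : InjOn f UHP := fun a ha b hb h => by rw [← hg a ha, h, hg b hb]
  have hcont : ∀ z ∈ UHP, ContinuousAt g (f z) := by
    intro z hz
    rw [ContinuousAt, hg z hz]
    intro s hs
    have hs' : s ∩ UHP ∈ 𝓝 z := inter_mem hs (isOpen_UHP.mem_nhds hz)
    obtain ⟨t, hts, hto, hzt⟩ := mem_nhds_iff.1 hs'
    have ht : t ⊆ UHP := fun x hx => (hts hx).2
    rw [mem_map]
    refine mem_of_superset ((isOpen_image_of_injOn hf hi ht hto).mem_nhds ⟨z, hzt, rfl⟩) ?_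
    rintro _ ⟨x, hx, rfl⟩
    change g (f x) ∈ s
    rw [hg x (ht hx)]
    exact (hts hx).1
  have hopen : IsOpen (f '' UHP) := isOpen_image_of_injOn hf hi subset_rfl isOpen_UHP
  have hderiv : ∀ z ∈ UHP, deriv f z ≠ 0 → DifferentiableAt ℂ g (f z) := by
    intro z hz hd
    refine (HasDerivAt.of_local_left_inverse (f := f) (hcont z hz) ?_ hd ?_).differentiableAt
    · rw [hg z hz]
      exact (hf.differentiableAt (isOpen_UHP.mem_nhds hz)).hasDerivAt
    · filter_upwards [hopen.mem_nhds ⟨z, hz, rfl⟩]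
      rintro _ ⟨x, hx, rfl⟩
      rw [hg x hx]
  rintro _ ⟨z, hz, rfl⟩
  refine DifferentiableAt.differentiableWithinAt ?_
  have hana : AnalyticOnNhd ℂ (deriv f) UHP := (hf.analyticOnNhd isOpen_UHP).deriv
  have hev : ∀ᶠ x in 𝓝[≠] z, deriv f x ≠ 0 := by
    rcases (hana z hz).eventually_eq_zero_or_eventually_ne_zero with h | h
    · exfalso
      have h0 : EqOn (deriv f) 0 UHP :=
        hana.eqOn_zero_of_preconnected_of_eventuallyEq_zero convex_UHP.isPreconnected hz h
      have h1 : I ∈ UHP := by simp [UHP]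
      have h2 : 2 * I ∈ UHP := by simp [UHP]
      have h3 := isOpen_UHP.is_const_of_deriv_eq_zero convex_UHP.isPreconnected hf h0 h1 h2
      have h4 := congrArg Complex.im (hi h1 h2 h3)
      norm_num at h4
    · exact h
  have hev2 : ∀ᶠ y in 𝓝[≠] (f z), DifferentiableAt ℂ g y := by
    have h1 : Tendsto g (𝓝[≠] (f z)) (𝓝[≠] z) := by
      refine tendsto_nhdsWithin_iff.2 ⟨?_, ?_⟩
      · have := hcont z hz
        rw [ContinuousAt, hg z hz] at this
        exact this.mono_left nhdsWithin_le_nhds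
      · filter_upwards [self_mem_nhdsWithin,
          mem_nhdsWithin_of_mem_nhds (hopen.mem_nhds ⟨z, hz, rfl⟩)]
        rintro _ hne ⟨x, hx, rfl⟩
        change g (f x) ≠ z
        rw [hg x hx]
        rintro rfl
        exact hne rfl
    filter_upwards [h1.eventually hev,
      mem_nhdsWithin_of_mem_nhds (hopen.mem_nhds ⟨z, hz, rfl⟩)]
    rintro _ hne ⟨x, hx, rfl⟩
    rw [hg x hx] at hne
    exact hderiv x hx hne
  obtain ⟨s, hs, hs'⟩ := (eventually_nhdsWithin_iff.1 hev2).exists_mem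
  refine DifferentiableOn.differentiableAt
    ((differentiableOn_compl_singleton_and_continuousAt_iff hs).1 ⟨?_, hcont z hz⟩) hs
  intro y hy
  exact (hs' y hy.1 hy.2).differentiableWithinAt

theorem normSq_sub_conj (z w : ℂ) :
    ‖z - (starRingEnd ℂ) w‖ ^ 2 = ‖z - w‖ ^ 2 + 4 * (z.im * w.im) := by
  simp only [← Complex.normSq_eq_norm_sq, Complex.normSq_apply]
  simp
  ring

/-- The **Schwarz–Pick lemma** for the upper half-plane. -/
theorem schwarz_pick_UHP {f : ℂ → ℂ} (hf : DifferentiableOn ℂ f UHP) (hm : MapsTo f UHP UHP)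
    {z w : ℂ} (hz : z ∈ UHP) (hw : w ∈ UHP) :
    ‖f z - f w‖ ^ 2 * (z.im * w.im) ≤ ‖z - w‖ ^ 2 * ((f z).im * (f w).im) := by
  have key : ∀ {u v : ℂ}, u ∈ UHP → v ∈ UHP → u - (starRingEnd ℂ) v ≠ 0 := by
    intro u v hu hv h
    have := congrArg Complex.im h
    simp only [Complex.sub_im, Complex.conj_im, Complex.zero_im] at this
    have hu' : 0 < u.im := hu
    have hv' : 0 < v.im := hv
    linarith
  have hlt : ∀ {u v : ℂ}, u ∈ UHP → v ∈ UHP → ‖(u - v) / (u - (starRingEnd ℂ) v)‖ < 1 := by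
    intro u v hu hv
    rw [norm_div, div_lt_one (norm_pos_iff.2 (key hu hv))]
    refine lt_of_pow_lt_pow_left₀ 2 (norm_nonneg _) ?_
    rw [normSq_sub_conj]
    have := mul_pos (show 0 < u.im from hu) (show 0 < v.im from hv)
    linarith
  set C : ℂ → ℂ := fun ζ => (w - (starRingEnd ℂ) w * ζ) / (1 - ζ) with hC
  have hne : ∀ ζ ∈ Metric.ball (0 : ℂ) 1, 1 - ζ ≠ 0 := by
    intro ζ hζ h
    rw [sub_eq_zero] at h
    rw [← h] at hζ
    simp at hζ
  have hCm : MapsTo C (Metric.ball 0 1) UHP := by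
    intro ζ hζ
    have h1 := hne ζ hζ
    have h2 : C ζ = ((w - (starRingEnd ℂ) w * ζ) * (starRingEnd ℂ) (1 - ζ))
        * (((Complex.normSq (1 - ζ))⁻¹ : ℝ) : ℂ) := by
      rw [hC]
      simp only [div_eq_mul_inv, Complex.inv_def]
      ring
    change 0 < (C ζ).im
    rw [h2, Complex.im_mul_ofReal]
    refine mul_pos ?_ (inv_pos.2 (Complex.normSq_pos.2 h1))
    have h3 : Complex.normSq ζ < 1 := by
      rw [Complex.normSq_eq_norm_sq]
      have : ‖ζ‖ < 1 := by simpa using hζ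
      nlinarith [norm_nonneg ζ]
    rw [Complex.normSq_apply] at h3
    have hw' : 0 < w.im := hw
    simp
    nlinarith
  have hCd : DifferentiableOn ℂ C (Metric.ball 0 1) := by
    intro ζ hζ
    have := hne ζ hζ
    simp only [hC]
    fun_prop (disch := assumption)
  have hfw := hm hw
  have hh := Complex.norm_le_norm_of_mapsTo_ball (R := 1)
    (f := fun ζ => (f (C ζ) - f w) / (f (C ζ) - (starRingEnd ℂ) (f w)))
    (z := (z - w) / (z - (starRingEnd ℂ) w)) ?_ ?_ ?_ ?_
  · have h1 := key hz hw
    have h2 : C ((z - w) / (z - (starRingEnd ℂ) w)) = z := by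
      have h3 := key hw hw
      have h4 : 1 - (z - w) / (z - (starRingEnd ℂ) w) ≠ 0 := hne _ (by simpa using hlt hz hw)
      simp only [hC]
      rw [div_eq_iff h4]
      field_simp
      ring
    simp only [h2, norm_div] at hh
    rw [div_le_div_iff₀ (norm_pos_iff.2 (key (hm hz) hfw)) (norm_pos_iff.2 h1)] at hh
    have h5 := pow_le_pow_left₀ (by positivity) hh 2
    rw [mul_pow, mul_pow, normSq_sub_conj, normSq_sub_conj] at h5
    linarith
  · have hcomp := hf.comp hCd hCm
    refine DifferentiableOn.div (hcomp.sub_const _) (hcomp.sub_const _) ?_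
    intro ζ hζ
    exact key (hm (hCm hζ)) hfw
  · intro ζ hζ
    simpa using (hlt (hm (hCm hζ)) hfw).le
  · simp [hC]
  · exact hlt hz hw

theorem im_le_im_of_asymptotic {A B : ℂ} {p q : ℝ → ℂ}
    (hp : Tendsto (fun t : ℝ => p t - t * I) atTop (𝓝 0))
    (hq : Tendsto (fun t : ℝ => q t - t * I) atTop (𝓝 0))
    (h : ∀ᶠ t : ℝ in atTop,
      ‖A - p t‖ ^ 2 * (B.im * (q t).im) ≤ ‖B - q t‖ ^ 2 * (A.im * (p t).im)) :
    B.im ≤ A.im := by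
  have hinv : Tendsto (fun t : ℝ => (t : ℂ)⁻¹) atTop (𝓝 0) := by
    have := (Complex.continuous_ofReal.tendsto 0).comp tendsto_inv_atTop_zero
    refine (this.congr fun t => ?_).trans (by simp)
    simp
  have hdiv : ∀ {r : ℝ → ℂ}, Tendsto (fun t : ℝ => r t - t * I) atTop (𝓝 0) →
      Tendsto (fun t : ℝ => r t / t) atTop (𝓝 I) := by
    intro r hr
    have h1 := (hr.mul hinv).add_const I
    simp only [zero_mul, zero_add] at h1
    refine h1.congr' ?_
    filter_upwards [eventually_gt_atTop 0] with t ht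
    have : (t : ℂ) ≠ 0 := by exact_mod_cast ht.ne'
    field_simp
    ring
  have hnorm : ∀ {r : ℝ → ℂ} (D : ℂ), Tendsto (fun t : ℝ => r t - t * I) atTop (𝓝 0) →
      Tendsto (fun t : ℝ => ‖D * (t : ℂ)⁻¹ - r t / t‖ ^ 2) atTop (𝓝 1) := by
    intro r D hr
    have := (((hinv.const_mul D).sub (hdiv hr)).norm).pow 2
    simpa using this
  have him : ∀ {r : ℝ → ℂ}, Tendsto (fun t : ℝ => r t - t * I) atTop (𝓝 0) →
      Tendsto (fun t : ℝ => (r t / t).im) atTop (𝓝 1) := by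
    intro r hr
    exact (Complex.continuous_im.tendsto I).comp (hdiv hr)
  have h1 := (hnorm A hp).mul ((him hq).const_mul B.im)
  have h2 := (hnorm B hq).mul ((him hp).const_mul A.im)
  simp only [mul_one, one_mul] at h1 h2
  refine le_of_tendsto_of_tendsto h1 h2 ?_
  filter_upwards [h, eventually_gt_atTop 0] with t ht ht0
  have e1 : ∀ D r : ℂ, ‖D * (t : ℂ)⁻¹ - r / t‖ ^ 2 = ‖D - r‖ ^ 2 * (t⁻¹) ^ 2 := by
    intro D r
    rw [div_eq_mul_inv, ← sub_mul, norm_mul, mul_pow, norm_inv, Complex.norm_real,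
      Real.norm_of_nonneg ht0.le]
  have e2 : ∀ r : ℂ, (r / t).im = r.im * t⁻¹ := by
    intro r
    rw [Complex.div_ofReal_im, div_eq_mul_inv]
  rw [e1, e1, e2, e2]
  have : 0 ≤ t⁻¹ ^ 3 := by positivity
  nlinarith [mul_le_mul_of_nonneg_right ht this]

/-- A conformal automorphism of the upper half-plane which is asymptotic to the identity along the
imaginary axis is the identity. -/
theorem eqOn_id_of_bijOn_UHP {f : ℂ → ℂ} (hf : DifferentiableOn ℂ f UHP)
    (hb : BijOn f UHP UHP) (hlim : Tendsto (fun t : ℝ => f (t * I) - t * I) atTop (𝓝 0)) :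
    EqOn f id UHP := by
  have hI : ∀ t : ℝ, 0 < t → (t : ℂ) * I ∈ UHP := fun t ht => by simpa [UHP] using ht
  have hleft : ∀ z ∈ UHP, Function.invFunOn f UHP (f z) = z := fun z hz =>
    hb.injOn.leftInvOn_invFunOn hz
  have hd := differentiableOn_leftInverse hf hleft
  rw [hb.image_eq] at hd
  have hm : MapsTo (Function.invFunOn f UHP) UHP UHP := hb.surjOn.mapsTo_invFunOn
  have hq : Tendsto (fun t : ℝ => (t : ℂ) * I - t * I) atTop (𝓝 0) := by simp
  have him : ∀ z ∈ UHP, (f z - z).im = 0 := by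
    intro z hz
    rw [Complex.sub_im, sub_eq_zero]
    apply le_antisymm
    · refine im_le_im_of_asymptotic hq hlim ?_
      filter_upwards [eventually_gt_atTop 0] with t ht
      have := schwarz_pick_UHP hd hm (hb.mapsTo hz) (hb.mapsTo (hI t ht))
      rwa [hleft z hz, hleft _ (hI t ht)] at this
    · refine im_le_im_of_asymptotic hlim hq ?_
      filter_upwards [eventually_gt_atTop 0] with t ht
      exact schwarz_pick_UHP hf hb.mapsTo hz (hI t ht)
  have hdiff : DifferentiableOn ℂ (fun z => f z - z) UHP := hf.sub differentiableOn_id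
  rcases (hdiff.analyticOnNhd isOpen_UHP).is_constant_or_isOpen convex_UHP.isPreconnected with
    ⟨c, hc⟩ | h
  · have hc0 : c = 0 := by
      refine tendsto_nhds_unique (tendsto_const_nhds.congr' ?_) hlim
      filter_upwards [eventually_gt_atTop 0] with t ht
      exact (hc _ (hI t ht)).symm
    intro z hz
    have := hc z hz
    rw [hc0, sub_eq_zero] at this
    exact this
  · exfalso
    have ho := h UHP subset_rfl isOpen_UHP
    have h1 : I ∈ UHP := by simp [UHP]
    have hmem := ho.mem_nhds ⟨I, h1, rfl⟩
    obtain ⟨ε, hε, hball⟩ := Metric.mem_nhds_iff.1 hmem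
    have : f I - I + (ε / 2 : ℝ) * I ∈ (fun z => f z - z) '' UHP := by
      apply hball
      rw [Metric.mem_ball, dist_eq_norm, add_sub_cancel_left, norm_mul, Complex.norm_I,
        Complex.norm_real, mul_one, Real.norm_of_nonneg (by linarith)]
      linarith
    obtain ⟨z, hz, hzz⟩ := this
    have h2 := him z hz
    simp only at hzz
    rw [hzz, Complex.add_im, him I h1] at h2
    simp at h2
    linarith

/-- A conformal map `f` from the upper half-plane onto the complement of a hull, asymptotic to the
identity along the imaginary axis, determines the boundary values of the mapping-out function. -/
theorem IsMappingOut.boundary_value_eq {K : Set ℂ} {g f : ℂ → ℂ} {w w₀ tip : ℂ}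
    (hg : IsMappingOut K g) (hgw : Tendsto g (𝓝[UHP \ K] tip) (𝓝 w))
    (hf : DifferentiableOn ℂ f UHP) (hb : BijOn f UHP (UHP \ K))
    (hlim : Tendsto (fun t : ℝ => f (t * I) - t * I) atTop (𝓝 0))
    (hcl : w₀ ∈ closure UHP) (hft : Tendsto f (𝓝[UHP] w₀) (𝓝 tip)) : w = w₀ := by
  obtain ⟨hgd, hgb, hgl⟩ := hg
  have hI : ∀ t : ℝ, 0 < t → (t : ℂ) * I ∈ UHP := fun t ht => by simpa [UHP] using ht
  have hid : EqOn (g ∘ f) id UHP := by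
    refine eqOn_id_of_bijOn_UHP (hgd.comp hf hb.mapsTo) (hgb.comp hb) ?_
    have h1 : Tendsto (fun t : ℝ => f (t * I))
        atTop (comap (fun z : ℂ => ‖z‖) atTop ⊓ 𝓟 (UHP \ K)) := by
      refine tendsto_inf.2 ⟨tendsto_comap_iff.2 ?_, tendsto_principal.2 ?_⟩
      · have h2 : Tendsto (fun t : ℝ => t - ‖f (t * I) - t * I‖) atTop atTop :=
          tendsto_atTop_add_right_of_le' _ (-1) tendsto_id (by
            have := hlim.norm.eventually (gt_mem_nhds (show ‖(0 : ℂ)‖ < 1 by simp))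
            filter_upwards [this] with t ht
            linarith)
        refine tendsto_atTop_mono' _ ?_ h2
        filter_upwards [eventually_gt_atTop 0] with t ht
        have h3 := norm_sub_norm_le ((t : ℂ) * I) (t * I - f (t * I))
        rw [sub_sub_cancel, norm_sub_rev ((t : ℂ) * I)] at h3
        simpa [abs_of_pos ht] using h3
      · filter_upwards [eventually_gt_atTop 0] with t ht
        exact hb.mapsTo (hI t ht)
    have h2 := (hgl.comp h1).add hlim
    simpa using h2
  have : (𝓝[UHP] w₀).NeBot := mem_closure_iff_nhdsWithin_neBot.1 hcl
  have h1 : Tendsto (g ∘ f) (𝓝[UHP] w₀) (𝓝 w) := by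
    refine hgw.comp (tendsto_nhdsWithin_iff.2 ⟨hft, ?_⟩)
    filter_upwards [self_mem_nhdsWithin] with z hz
    exact hb.mapsTo hz
  refine tendsto_nhds_unique h1 (Tendsto.congr' ?_ (tendsto_id.mono_left nhdsWithin_le_nhds))
  filter_upwards [self_mem_nhdsWithin] with z hz
  exact (hid hz).symm

section SlitMap

variable {p q c : ℝ}

/-- A logarithm of `slitMap p q c z / I`. -/
noncomputable def slitLog (p q c : ℝ) (z : ℂ) : ℂ :=
  p * log (-I * (z - (q * c : ℝ))) + q * log (-I * (z + (p * c : ℝ)))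

/-- The Schwarz–Christoffel map `(z - q c) ^ p * (z + p c) ^ q` from the upper half-plane onto the
upper half-plane slit along a straight segment starting at `0`. -/
noncomputable def slitMap (p q c : ℝ) (z : ℂ) : ℂ :=
  I * ((-I * (z - (q * c : ℝ))) ^ (p : ℂ) * (-I * (z + (p * c : ℝ))) ^ (q : ℂ))

theorem slitMap_eq_exp {z : ℂ} (h₁ : z ≠ (q * c : ℝ)) (h₂ : z ≠ (-(p * c) : ℝ)) :
    slitMap p q c z = I * exp (slitLog p q c z) := by
  have h₁' : -I * (z - (q * c : ℝ)) ≠ 0 := mul_ne_zero (by simp) (sub_ne_zero.2 h₁)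
  have h₂' : -I * (z + (p * c : ℝ)) ≠ 0 := by
    refine mul_ne_zero (by simp) fun h => h₂ ?_
    rw [eq_neg_of_add_eq_zero_left h, ofReal_neg]
  rw [slitMap, slitLog, cpow_def_of_ne_zero h₁', cpow_def_of_ne_zero h₂', ← exp_add]
  ring_nf

theorem ne_ofReal_of_mem_UHP {z : ℂ} (hz : z ∈ UHP) (t : ℝ) : z ≠ t := by
  rintro rfl
  simp [UHP] at hz

theorem slitMap_eq_exp_of_mem_UHP {z : ℂ} (hz : z ∈ UHP) :
    slitMap p q c z = I * exp (slitLog p q c z) :=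
  slitMap_eq_exp (ne_ofReal_of_mem_UHP hz _) (ne_ofReal_of_mem_UHP hz _)

theorem continuousAt_slitMap (hp : 0 < p) (hq : 0 < q) {z : ℂ} (hz : 0 ≤ z.im) :
    ContinuousAt (slitMap p q c) z := by
  refine continuousAt_const.mul (ContinuousAt.mul ?_ ?_)
  · refine (continuousAt_cpow_const_of_re_pos (Or.inl ?_) (by simpa using hp)).comp
      (f := fun z : ℂ => -I * (z - (q * c : ℝ))) (by fun_prop)
    simpa using hz
  · refine (continuousAt_cpow_const_of_re_pos (Or.inl ?_) (by simpa using hq)).comp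
      (f := fun z : ℂ => -I * (z + (p * c : ℝ))) (by fun_prop)
    simpa using hz

theorem neg_I_mul_sub_mem_slitPlane {z : ℂ} {t : ℝ} (hz : 0 ≤ z.im) (h : z ≠ t) :
    -I * (z - t) ∈ slitPlane := by
  rw [mem_slitPlane_iff]
  rcases hz.lt_or_eq with h0 | h0
  · left
    simpa using h0
  · right
    intro h1
    refine h (Complex.ext ?_ ?_)
    · simp at h1
      simp
      linarith
    · simp [← h0]

theorem hasDerivAt_slitLog {z : ℂ} (hz : 0 ≤ z.im) (h₁ : z ≠ (q * c : ℝ))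
    (h₂ : z ≠ (-(p * c) : ℝ)) :
    HasDerivAt (slitLog p q c) (p * (z - (q * c : ℝ))⁻¹ + q * (z + (p * c : ℝ))⁻¹) z := by
  have e : ∀ w : ℂ, w + (p * c : ℝ) = w - (-(p * c) : ℝ) := fun w => by
    rw [ofReal_neg, sub_neg_eq_add]
  have key : ∀ t : ℝ, z ≠ t →
      HasDerivAt (fun w : ℂ => log (-I * (w - t))) (z - t)⁻¹ z := by
    intro t ht
    have h := ((((hasDerivAt_id z).sub_const (t : ℂ)).const_mul (-I)).clog
      (neg_I_mul_sub_mem_slitPlane hz ht))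
    convert h using 1
    simp only [id]
    field_simp
    exact (div_self (sub_ne_zero.2 ht)).symm
  have h := ((key _ h₁).const_mul (p : ℂ)).add ((key _ h₂).const_mul (q : ℂ))
  simp only [← e] at h
  exact h

theorem im_deriv_slitLog_neg (hp : 0 < p) (hq : 0 < q) {z : ℂ} (hz : z ∈ UHP) :
    ((p : ℂ) * (z - (q * c : ℝ))⁻¹ + q * (z + (p * c : ℝ))⁻¹).im < 0 := by
  have key : ∀ t : ℝ, ((z - t)⁻¹).im < 0 := by
    intro t
    rw [inv_im]
    have h0 : 0 < normSq (z - t) := normSq_pos.2 (sub_ne_zero.2 (ne_ofReal_of_mem_UHP hz t))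
    have hz' : 0 < z.im := hz
    simp only [sub_im, ofReal_im, sub_zero]
    exact div_neg_of_neg_of_pos (neg_neg_of_pos hz') h0
  have h1 := key (q * c)
  have h2 := key (-(p * c))
  rw [ofReal_neg, sub_neg_eq_add] at h2
  rw [add_im, im_ofReal_mul, im_ofReal_mul]
  nlinarith

theorem im_slitLog_slope_neg (hp : 0 < p) (hq : 0 < q) {z t : ℂ} (hz : z ∈ UHP) (ht : 0 ≤ t.im)
    (h₁ : t ≠ (q * c : ℝ)) (h₂ : t ≠ (-(p * c) : ℝ)) (hzt : z ≠ t) :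
    ((slitLog p q c z - slitLog p q c t) / (z - t)).im < 0 := by
  have hzt' : z - t ≠ 0 := sub_ne_zero.2 hzt
  have hz' : 0 < z.im := hz
  set γ : ℝ → ℂ := fun s => t + s * (z - t) with hγ
  have hγU : ∀ s : ℝ, 0 < s → s ≤ 1 → γ s ∈ UHP := by
    intro s hs hs1
    change 0 < (γ s).im
    simp only [hγ, add_im, im_ofReal_mul, sub_im]
    nlinarith [mul_nonneg (sub_nonneg.2 hs1) ht, mul_pos hs hz']
  have hγd : ∀ s : ℝ, HasDerivAt γ (z - t) s := by
    intro s
    have := ((hasDerivAt_id s).ofReal_comp.mul_const (z - t)).const_add t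
    rw [ofReal_one, one_mul] at this
    exact this
  have hd : ∀ s : ℝ, 0 ≤ (γ s).im → γ s ≠ (q * c : ℝ) → γ s ≠ (-(p * c) : ℝ) →
      HasDerivAt (fun s => (slitLog p q c (γ s) / (z - t)).im)
        ((p : ℂ) * (γ s - (q * c : ℝ))⁻¹ + q * (γ s + (p * c : ℝ))⁻¹).im s := by
    intro s hs hs1 hs2
    have h := ((hasDerivAt_slitLog hs hs1 hs2).comp s (hγd s)).div_const (z - t)
    rw [mul_div_cancel_right₀ _ hzt'] at h
    exact imCLM.hasFDerivAt.comp_hasDerivAt s h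
  have hdU : ∀ s : ℝ, 0 < s → s ≤ 1 → _ := fun s hs hs1 =>
    hd s (le_of_lt (hγU s hs hs1)) (ne_ofReal_of_mem_UHP (hγU s hs hs1) _)
      (ne_ofReal_of_mem_UHP (hγU s hs hs1) _)
  have hanti : StrictAntiOn (fun s => (slitLog p q c (γ s) / (z - t)).im) (Icc 0 1) := by
    refine strictAntiOn_of_deriv_neg (convex_Icc 0 1) ?_ ?_
    · intro s hs
      refine ContinuousAt.continuousWithinAt ?_
      rcases hs.1.eq_or_lt with rfl | h0
      · have e : γ 0 = t := by simp [hγ]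
        exact (hd 0 (by rwa [e]) (by rwa [e]) (by rwa [e])).continuousAt
      · exact (hdU s h0 hs.2).continuousAt
    · intro s hs
      rw [interior_Icc] at hs
      rw [(hdU s hs.1 hs.2.le).deriv]
      exact im_deriv_slitLog_neg hp hq (hγU s hs.1 hs.2.le)
  have h := hanti (left_mem_Icc.2 zero_le_one) (right_mem_Icc.2 zero_le_one) zero_lt_one
  simp only [hγ, ofReal_zero, ofReal_one, zero_mul, one_mul, add_zero, add_sub_cancel] at h
  rw [sub_div, sub_im]
  linarith

theorem abs_im_slitLog_lt (hp : 0 < p) (hq : 0 < q) (hpq : p + q = 1) {z : ℂ} (hz : z ∈ UHP) :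
    |(slitLog p q c z).im| < Real.pi / 2 := by
  have h1 : |(-I * (z - (q * c : ℝ))).arg| < Real.pi / 2 :=
    abs_arg_lt_pi_div_two_iff.2 (Or.inl (by simpa [UHP] using hz))
  have h2 : |(-I * (z + (p * c : ℝ))).arg| < Real.pi / 2 :=
    abs_arg_lt_pi_div_two_iff.2 (Or.inl (by simpa [UHP] using hz))
  rw [slitLog, add_im, im_ofReal_mul, im_ofReal_mul, log_im, log_im]
  rw [abs_lt] at *
  constructor <;> nlinarith

theorem slitMap_mapsTo_UHP (hp : 0 < p) (hq : 0 < q) (hpq : p + q = 1) :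
    MapsTo (slitMap p q c) UHP UHP := by
  intro z hz
  change 0 < (slitMap p q c z).im
  rw [slitMap_eq_exp_of_mem_UHP hz, I_mul_im, exp_re]
  exact mul_pos (Real.exp_pos _)
    (Real.cos_pos_of_mem_Ioo (abs_lt.1 (abs_im_slitLog_lt hp hq hpq hz)))

theorem differentiableOn_slitMap : DifferentiableOn ℂ (slitMap p q c) UHP := by
  intro z hz
  have h : DifferentiableWithinAt ℂ (fun z => I * exp (slitLog p q c z)) UHP z :=
    ((hasDerivAt_slitLog (le_of_lt hz) (ne_ofReal_of_mem_UHP hz _)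
      (ne_ofReal_of_mem_UHP hz _)).differentiableAt.cexp.const_mul I).differentiableWithinAt
  exact h.congr (fun w hw => slitMap_eq_exp_of_mem_UHP hw) (slitMap_eq_exp_of_mem_UHP hz)

theorem injOn_slitMap (hp : 0 < p) (hq : 0 < q) (hpq : p + q = 1) :
    InjOn (slitMap p q c) UHP := by
  intro z hz w hw h
  rw [slitMap_eq_exp_of_mem_UHP hz, slitMap_eq_exp_of_mem_UHP hw] at h
  have hz' := abs_lt.1 (abs_im_slitLog_lt (c := c) hp hq hpq hz)
  have hw' := abs_lt.1 (abs_im_slitLog_lt (c := c) hp hq hpq hw)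
  have hπ := Real.pi_pos
  have h1 := exp_inj_of_neg_pi_lt_of_le_pi (by linarith) (by linarith) (by linarith) (by linarith)
    (mul_left_cancel₀ I_ne_zero h)
  by_contra hne
  have h2 := im_slitLog_slope_neg (c := c) hp hq hz (le_of_lt hw) (ne_ofReal_of_mem_UHP hw _)
    (ne_ofReal_of_mem_UHP hw _) hne
  rw [h1] at h2
  simp at h2

theorem norm_le_norm_slitMap_add (hp : 0 < p) (hq : 0 < q) (hpq : p + q = 1) (hc : 0 < c) {z : ℂ}
    (hz : z ∈ UHP) : ‖z‖ ≤ ‖slitMap p q c z‖ + c := by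
  rcases le_or_gt ‖z‖ c with h | h
  · linarith [norm_nonneg (slitMap p q c z)]
  have h0 : 0 < ‖z‖ - c := sub_pos.2 h
  have h1 : ‖z‖ - c ≤ ‖-I * (z - (q * c : ℝ))‖ := by
    have := norm_sub_norm_le z (q * c : ℝ)
    rw [norm_real, Real.norm_of_nonneg (by positivity)] at this
    rw [norm_mul, norm_neg, norm_I, one_mul]
    nlinarith
  have h2 : ‖z‖ - c ≤ ‖-I * (z + (p * c : ℝ))‖ := by
    have := norm_sub_le_norm_add z (p * c : ℝ)
    rw [norm_real, Real.norm_of_nonneg (by positivity)] at this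
    rw [norm_mul, norm_neg, norm_I, one_mul]
    nlinarith
  have h3 : Real.log (‖z‖ - c) ≤ (slitLog p q c z).re := by
    rw [slitLog, add_re, re_ofReal_mul, re_ofReal_mul, log_re, log_re]
    have e : Real.log (‖z‖ - c) = p * Real.log (‖z‖ - c) + q * Real.log (‖z‖ - c) := by
      rw [← add_mul, hpq, one_mul]
    rw [e]
    gcongr
  rw [slitMap_eq_exp_of_mem_UHP hz, norm_mul, norm_I, one_mul, norm_exp]
  have := Real.exp_le_exp.2 h3
  rw [Real.exp_log h0] at this
  linarith

theorem log_neg_I_mul_of_pos {s : ℝ} (hs : 0 < s) :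
    log (-I * s) = Real.log s - (Real.pi / 2 : ℝ) * I := by
  rw [mul_comm, log_ofReal_mul hs (by simp), log_neg_I]
  push_cast
  ring

theorem log_neg_I_mul_of_neg {s : ℝ} (hs : s < 0) :
    log (-I * s) = Real.log (-s) + (Real.pi / 2 : ℝ) * I := by
  have : -I * s = (-s : ℝ) * I := by
    push_cast
    ring
  rw [this, log_ofReal_mul (neg_pos.2 hs) (by simp), log_I]
  push_cast
  ring

theorem slitLog_ofReal_of_mem_Ioo {t : ℝ} (h₁ : -(p * c) < t) (h₂ : t < q * c) :
    slitLog p q c t = (p * Real.log (q * c - t) + q * Real.log (t + p * c) : ℝ)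
      + ((p - q) * (Real.pi / 2) : ℝ) * I := by
  rw [slitLog, ← ofReal_sub, ← ofReal_add, log_neg_I_mul_of_neg (by linarith),
    log_neg_I_mul_of_pos (by linarith), neg_sub]
  push_cast
  ring

theorem slitLog_criticalPoint (hp : 0 < p) (hq : 0 < q) (hc : 0 < c) :
    slitLog p q c ((q - p) * c : ℝ) = (p * Real.log (p * c) + q * Real.log (q * c) : ℝ)
      + ((p - q) * (Real.pi / 2) : ℝ) * I := by
  have := mul_pos hp hc
  have := mul_pos hq hc
  rw [slitLog_ofReal_of_mem_Ioo (by linarith) (by linarith)]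
  ring_nf

theorem mem_segment_zero_iff {z w : ℂ} :
    z ∈ segment ℝ 0 w ↔ ∃ r : ℝ, 0 ≤ r ∧ r ≤ 1 ∧ z = r * w := by
  rw [segment_eq_image]
  simp only [mem_image, mem_Icc, smul_zero, zero_add, real_smul]
  exact ⟨fun ⟨r, h, e⟩ => ⟨r, h.1, h.2, e.symm⟩, fun ⟨r, h, h', e⟩ => ⟨r, ⟨h, h'⟩, e.symm⟩⟩

theorem criticalPoint_ne (hp : 0 < p) (hq : 0 < q) (hc : 0 < c) :
    (((q - p) * c : ℝ) : ℂ) ≠ (q * c : ℝ) ∧ (((q - p) * c : ℝ) : ℂ) ≠ (-(p * c) : ℝ) := by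
  have := mul_pos hp hc
  have := mul_pos hq hc
  constructor <;> rw [Ne, ofReal_inj] <;> intro h <;> linarith

theorem slitMap_ofReal (hp : 0 < p) (hq : 0 < q) (hpq : p + q = 1) (hc : 0 < c) (t : ℝ) :
    slitMap p q c t ∉ UHP \ segment ℝ 0 (slitMap p q c ((q - p) * c : ℝ)) := by
  have hpc := mul_pos hp hc
  have hqc := mul_pos hq hc
  rintro ⟨hU, hK⟩
  have hU' : 0 < (slitMap p q c t).im := hU
  rcases eq_or_ne t (q * c) with rfl | h₁
  · rw [slitMap, sub_self, mul_zero, zero_cpow (by exact_mod_cast hp.ne')] at hU'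
    simp at hU'
  rcases eq_or_ne t (-(p * c)) with rfl | h₂
  · rw [slitMap, ofReal_neg, neg_add_cancel, mul_zero, zero_cpow (by exact_mod_cast hq.ne')] at hU'
    simp at hU'
  have hexp := slitMap_eq_exp (p := p) (q := q) (c := c) (z := t) (by exact_mod_cast h₁)
    (by exact_mod_cast h₂)
  have hπ : p * (Real.pi / 2) + q * (Real.pi / 2) = Real.pi / 2 := by rw [← add_mul, hpq, one_mul]
  rcases lt_or_gt_of_ne h₁ with h₁ | h₁
  · rcases lt_or_gt_of_ne h₂ with h₂ | h₂
    · have him : (slitLog p q c t).im = Real.pi / 2 := by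
        rw [slitLog, ← ofReal_sub, ← ofReal_add, log_neg_I_mul_of_neg (by linarith),
          log_neg_I_mul_of_neg (by linarith)]
        simpa using hπ
      rw [hexp, I_mul_im, exp_re, him, Real.cos_pi_div_two, mul_zero] at hU'
      exact lt_irrefl _ hU'
    · apply hK
      have hr : p * Real.log (q * c - t) + q * Real.log (t + p * c)
          ≤ p * Real.log (p * c) + q * Real.log (q * c) := by
        have key : ∀ u v : ℝ, 0 < u → 0 < v → Real.log u ≤ Real.log v + (u / v - 1) := by
          intro u v hu hv
          have := Real.log_le_sub_one_of_pos (div_pos hu hv)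
          rw [Real.log_div hu.ne' hv.ne'] at this
          linarith
        have k1 := key (q * c - t) (p * c) (by linarith) hpc
        have k2 := key (t + p * c) (q * c) (by linarith) hqc
        have k3 : p * ((q * c - t) / (p * c) - 1) + q * ((t + p * c) / (q * c) - 1) = 0 := by
          field_simp
          ring
        have := mul_le_mul_of_nonneg_left k1 hp.le
        have := mul_le_mul_of_nonneg_left k2 hq.le
        linarith
      rw [mem_segment_zero_iff]
      refine ⟨Real.exp ((p * Real.log (q * c - t) + q * Real.log (t + p * c))
        - (p * Real.log (p * c) + q * Real.log (q * c))), (Real.exp_pos _).le,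
        Real.exp_le_one_iff.2 (by linarith), ?_⟩
      rw [hexp, slitMap_eq_exp (criticalPoint_ne hp hq hc).1 (criticalPoint_ne hp hq hc).2,
        slitLog_criticalPoint hp hq hc, slitLog_ofReal_of_mem_Ioo h₂ h₁, ofReal_exp,
        mul_left_comm, ← exp_add]
      congr 2
      push_cast
      ring
  · have him : (slitLog p q c t).im = -(Real.pi / 2) := by
      rw [slitLog, ← ofReal_sub, ← ofReal_add, log_neg_I_mul_of_pos (by linarith),
        log_neg_I_mul_of_pos (by linarith)]
      simp only [add_im, im_ofReal_mul, sub_im, ofReal_im, I_im, mul_one]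
      linarith
    rw [hexp, I_mul_im, exp_re, him, Real.cos_neg, Real.cos_pi_div_two, mul_zero] at hU'
    exact lt_irrefl _ hU'

theorem slitMap_notMem_segment (hp : 0 < p) (hq : 0 < q) (hpq : p + q = 1) (hc : 0 < c) {z : ℂ}
    (hz : z ∈ UHP) : slitMap p q c z ∉ segment ℝ 0 (slitMap p q c ((q - p) * c : ℝ)) := by
  rw [mem_segment_zero_iff]
  rintro ⟨r, hr0, hr1, h⟩
  have hne := criticalPoint_ne hp hq hc
  rcases hr0.eq_or_lt with rfl | hr0
  · have := slitMap_mapsTo_UHP (c := c) hp hq hpq hz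
    rw [h] at this
    simp [UHP] at this
  have e : (r : ℂ) = exp (Real.log r : ℝ) := by rw [← ofReal_exp, Real.exp_log hr0]
  rw [slitMap_eq_exp_of_mem_UHP hz, slitMap_eq_exp hne.1 hne.2, e, mul_left_comm, ← exp_add] at h
  have hz' := abs_lt.1 (abs_im_slitLog_lt (c := c) hp hq hpq hz)
  have hπ := Real.pi_pos
  have him : ((Real.log r : ℝ) + slitLog p q c ((q - p) * c : ℝ)).im = (p - q) * (Real.pi / 2) := by
    rw [slitLog_criticalPoint hp hq hc]
    simp
  have h1 := exp_inj_of_neg_pi_lt_of_le_pi (by linarith) (by linarith)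
    (by rw [him]; nlinarith) (by rw [him]; nlinarith) (mul_left_cancel₀ I_ne_zero h)
  have h2 := im_slitLog_slope_neg hp hq hz (ofReal_im _).ge hne.1 hne.2 (ne_ofReal_of_mem_UHP hz _)
  rw [h1, add_sub_cancel_right, div_eq_mul_inv, im_ofReal_mul, inv_im] at h2
  have h3 : Real.log r ≤ 0 := Real.log_nonpos hr0.le hr1
  have hz0 : 0 < z.im := hz
  have h4 : -(z - (((q - p) * c : ℝ) : ℂ)).im / normSq (z - (((q - p) * c : ℝ) : ℂ)) ≤ 0 := by
    refine div_nonpos_of_nonpos_of_nonneg ?_ (normSq_nonneg _)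
    rw [sub_im, ofReal_im]
    linarith
  linarith [mul_nonneg_of_nonpos_of_nonpos h3 h4]

theorem isPreconnected_UHP_diff_segment {u : ℂ} (hu : u ∈ UHP) :
    IsPreconnected (UHP \ segment ℝ 0 u) := by
  have hu' : 0 < u.im := hu
  have hu0 : u ≠ 0 := by
    rintro rfl
    simp at hu'
  have hN : 0 < normSq u := normSq_pos.2 hu0
  set T : ℂ →ₗ[ℝ] ℂ := LinearMap.mulRight ℝ ((starRingEnd ℂ) u) with hT
  have hTu : ∀ z, T (u * z) = normSq u * z := by
    intro z
    rw [hT, LinearMap.mulRight_apply, mul_right_comm, mul_conj]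
  set A : Set ℂ := UHP ∩ T ⁻¹' {z | 0 < z.im}
  set B : Set ℂ := UHP ∩ T ⁻¹' {z | z.im < 0}
  set D : Set ℂ := UHP ∩ T ⁻¹' {z | normSq u < z.re}
  have hA : IsPreconnected A :=
    (convex_UHP.inter ((convex_halfSpace_im_gt 0).linear_preimage T)).isPreconnected
  have hB : IsPreconnected B :=
    (convex_UHP.inter ((convex_halfSpace_im_lt 0).linear_preimage T)).isPreconnected
  have hD : IsPreconnected D :=
    (convex_UHP.inter ((convex_halfSpace_re_gt (normSq u)).linear_preimage T)).isPreconnected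
  set ε : ℝ := u.im / (|u.re| + 1) with hε
  have hε0 : 0 < ε := by positivity
  have hε1 : |ε * u.re| < 2 * u.im := by
    rw [abs_mul, abs_of_pos hε0, hε, div_mul_eq_mul_div, div_lt_iff₀ (by positivity)]
    nlinarith [abs_nonneg u.re]
  rw [abs_lt] at hε1
  have hAD : (A ∩ D).Nonempty := by
    have h0 : u * (2 + ε * I) ∈ UHP := by
      simp [UHP]
      linarith
    refine ⟨u * (2 + ε * I), ⟨h0, ?_⟩, ⟨h0, ?_⟩⟩
    · rw [mem_preimage, hTu]
      simpa using mul_pos hN hε0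
    · rw [mem_preimage, hTu]
      simp
      linarith
  have hBD : (B ∩ D).Nonempty := by
    have h0 : u * (2 - ε * I) ∈ UHP := by
      simp [UHP]
      linarith
    refine ⟨u * (2 - ε * I), ⟨h0, ?_⟩, ⟨h0, ?_⟩⟩
    · rw [mem_preimage, hTu]
      simpa using mul_pos hN hε0
    · rw [mem_preimage, hTu]
      simp
      linarith
  have hADB : IsPreconnected (A ∪ D ∪ B) := by
    refine (hA.union' hAD hD).union' ?_ hB
    obtain ⟨x, hxB, hxD⟩ := hBD
    exact ⟨x, Or.inr hxD, hxB⟩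
  convert hADB using 1
  ext z
  have hz_eq : z = u * (T z / normSq u) := by
    have : (normSq u : ℂ) ≠ 0 := by exact_mod_cast hN.ne'
    rw [hT, LinearMap.mulRight_apply, ← mul_conj]
    have h2 : (starRingEnd ℂ) u ≠ 0 := by simpa using hu0
    field_simp
  constructor
  · rintro ⟨hz, hzK⟩
    rcases lt_trichotomy (T z).im 0 with h | h | h
    · exact Or.inr ⟨hz, h⟩
    · refine Or.inl (Or.inr ⟨hz, ?_⟩)
      change normSq u < (T z).re
      by_contra! hle
      apply hzK
      have e : T z = ((T z).re : ℂ) := Complex.ext rfl (by simpa using h)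
      have e2 : z = ((T z).re / normSq u : ℝ) * u := by
        rw [mul_comm, ofReal_div, ← e]
        exact hz_eq
      rw [mem_segment_zero_iff]
      refine ⟨_, ?_, (div_le_one hN).2 hle, e2⟩
      have hzi : 0 < z.im := hz
      rw [e2, im_ofReal_mul] at hzi
      exact (pos_of_mul_pos_left hzi hu'.le).le
    · exact Or.inl (Or.inl ⟨hz, h⟩)
  · have key : ∀ w ∈ segment ℝ 0 u, (T w).im = 0 ∧ (T w).re ≤ normSq u := by
      intro w hw
      obtain ⟨r, hr0, hr1, rfl⟩ := mem_segment_zero_iff.1 hw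
      rw [mul_comm, hTu, ← ofReal_mul]
      refine ⟨ofReal_im _, ?_⟩
      rw [ofReal_re]
      nlinarith
    rintro ((⟨hz, h⟩ | ⟨hz, h⟩) | ⟨hz, h⟩) <;> refine ⟨hz, fun hK => ?_⟩ <;>
      obtain ⟨k1, k2⟩ := key z hK
    · exact absurd k1 (ne_of_gt h)
    · exact absurd k2 (not_le_of_gt h)
    · exact absurd k1 (ne_of_lt h)

theorem slitMap_criticalPoint_mem_UHP (hp : 0 < p) (hq : 0 < q) (hpq : p + q = 1) (hc : 0 < c) :
    slitMap p q c ((q - p) * c : ℝ) ∈ UHP := by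
  have hne := criticalPoint_ne hp hq hc
  change 0 < (slitMap p q c _).im
  rw [slitMap_eq_exp hne.1 hne.2, I_mul_im, exp_re, slitLog_criticalPoint hp hq hc]
  refine mul_pos (Real.exp_pos _) (Real.cos_pos_of_mem_Ioo ?_)
  have hπ := Real.pi_pos
  constructor <;> simp <;> nlinarith

theorem bijOn_slitMap (hp : 0 < p) (hq : 0 < q) (hpq : p + q = 1) (hc : 0 < c) :
    BijOn (slitMap p q c) UHP (UHP \ segment ℝ 0 (slitMap p q c ((q - p) * c : ℝ))) := by
  have hm : MapsTo (slitMap p q c) UHP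
      (UHP \ segment ℝ 0 (slitMap p q c ((q - p) * c : ℝ))) := fun z hz =>
    ⟨slitMap_mapsTo_UHP hp hq hpq hz, slitMap_notMem_segment hp hq hpq hc hz⟩
  have hi := injOn_slitMap (c := c) hp hq hpq
  refine ⟨hm, hi, ?_⟩
  refine (isPreconnected_UHP_diff_segment
    (slitMap_criticalPoint_mem_UHP hp hq hpq hc)).subset_of_closure_inter_subset
    (isOpen_image_of_injOn differentiableOn_slitMap hi subset_rfl isOpen_UHP) ?_ ?_
  · have h1 : I ∈ UHP := by simp [UHP]
    exact ⟨slitMap p q c I, hm h1, I, h1, rfl⟩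
  · rintro w ⟨hw, hwS⟩
    have hcpt : IsCompact (slitMap p q c ''
        (Metric.closedBall 0 (‖w‖ + 1 + c) ∩ {z : ℂ | 0 ≤ z.im})) := by
      refine ((isCompact_closedBall _ _).inter_right
        (isClosed_le continuous_const continuous_im)).image_of_continuousOn ?_
      exact fun z hz => (continuousAt_slitMap hp hq hz.2).continuousWithinAt
    have hmem : w ∈ slitMap p q c ''
        (Metric.closedBall 0 (‖w‖ + 1 + c) ∩ {z : ℂ | 0 ≤ z.im}) := by
      rw [← hcpt.isClosed.closure_eq]
      have h1 := (Metric.isOpen_ball (x := w) (ε := 1)).inter_closure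
        ⟨Metric.mem_ball_self one_pos, hw⟩
      refine closure_mono ?_ h1
      rintro _ ⟨hb, z, hz, rfl⟩
      refine ⟨z, ⟨?_, le_of_lt (show 0 < z.im from hz)⟩, rfl⟩
      rw [mem_closedBall_zero_iff]
      have h2 := norm_le_norm_slitMap_add hp hq hpq hc hz
      rw [Metric.mem_ball, dist_eq_norm] at hb
      have h3 := norm_sub_norm_le (slitMap p q c z) w
      linarith
    obtain ⟨z, ⟨-, hz⟩, rfl⟩ := hmem
    rcases (show 0 ≤ z.im from hz).eq_or_lt with h0 | h0
    · exfalso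
      have e : z = (z.re : ℂ) := Complex.ext rfl (by simpa using h0.symm)
      rw [e] at hwS
      exact slitMap_ofReal hp hq hpq hc _ hwS
    · exact ⟨z, h0, rfl⟩

theorem tendsto_slitMap_sub (hpq : p + q = 1) :
    Tendsto (fun t : ℝ => slitMap p q c (t * I) - t * I) atTop (𝓝 0) := by
  set E : ℝ → ℂ := fun s =>
    exp (p * log (1 + s * ((q * c : ℝ) * I)) + q * log (1 + s * (-(p * c : ℝ) * I))) with hE
  have key : ∀ a : ℂ, HasDerivAt (fun s : ℝ => log (1 + s * a)) a 0 := by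
    intro a
    have h := (((hasDerivAt_id (0 : ℝ)).ofReal_comp.mul_const a).const_add 1).clog_real
      (by simp)
    simpa using h
  have hd : HasDerivAt E 0 0 := by
    have h := (((key ((q * c : ℝ) * I)).const_mul (p : ℂ)).add
      ((key (-(p * c : ℝ) * I)).const_mul (q : ℂ))).cexp
    have e : (p : ℂ) * ((q * c : ℝ) * I) + q * (-(p * c : ℝ) * I) = 0 := by
      push_cast
      ring
    rw [e, mul_zero] at h
    exact h
  have h1 := (hasDerivAt_iff_tendsto_slope_zero.1 hd).comp
    (tendsto_inv_atTop_nhdsGT_zero.mono_right (nhdsWithin_mono _ fun x hx => ne_of_gt hx))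
  have h2 := h1.const_mul I
  rw [mul_zero] at h2
  refine h2.congr' ?_
  filter_upwards [eventually_gt_atTop 0] with t ht
  have ht0 : (t : ℂ) ≠ 0 := by exact_mod_cast ht.ne'
  have hU : (t : ℂ) * I ∈ UHP := by simpa [UHP] using ht
  have hlog : ∀ a : ℝ, log (-I * (t * I - a)) = Real.log t + log (1 + (t⁻¹ : ℝ) * (a * I)) := by
    intro a
    have e : -I * (t * I - a) = t * (1 + (t⁻¹ : ℝ) * (a * I)) := by
      push_cast
      field_simp
      linear_combination (-(t : ℂ)) * I_sq
    rw [e, log_ofReal_mul ht]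
    intro h
    have := congrArg Complex.re h
    simp at this
  have hL : slitLog p q c (t * I) = Real.log t +
      (p * log (1 + (t⁻¹ : ℝ) * ((q * c : ℝ) * I))
        + q * log (1 + (t⁻¹ : ℝ) * (-(p * c : ℝ) * I))) := by
    have e : (t : ℂ) * I + (p * c : ℝ) = t * I - (-(p * c) : ℝ) := by
      push_cast
      ring
    have hpq' : (p : ℂ) + q = 1 := by exact_mod_cast hpq
    rw [slitLog, e, hlog, hlog, ofReal_neg]
    linear_combination (Real.log t : ℂ) * hpq'
  have hE0 : E 0 = 1 := by simp [hE]
  simp only [Function.comp_apply, zero_add, hE0]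
  rw [slitMap_eq_exp_of_mem_UHP hU, hL, exp_add, ← ofReal_exp, Real.exp_log ht, inv_inv, real_smul]
  ring

end SlitMap

/-- The mapping-out function of the segment `[0, x + iy]` sends the tip to a point of modulus at
most `2|x|`. -/
theorem norm_tip_le {x y : ℝ} (hxy : |x| ≤ y) {g : ℂ → ℂ} {w : ℂ}
    (hg : IsMappingOut (segment ℝ (0 : ℂ) (x + y * I)) g)
    (hw : Tendsto g (𝓝[UHP \ segment ℝ (0 : ℂ) (x + y * I)] (x + y * I)) (𝓝 w)) :
    ‖w‖ ≤ 2 * |x| := by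
  have hreal : ∀ t : ℝ, (t : ℂ) ∈ closure UHP := by
    intro t
    rw [UHP, closure_setOfPred_lt_im]
    simp
  rcases ((abs_nonneg x).trans hxy).eq_or_lt with hy | hy
  · obtain rfl : x = 0 := by
      rw [← hy] at hxy
      exact abs_nonpos_iff.1 hxy
    subst hy
    have e : ((0 : ℝ) : ℂ) + ((0 : ℝ) : ℂ) * I = 0 := by simp
    rw [e, segment_same] at hg hw
    have hd : UHP \ {0} = UHP := by
      refine sdiff_singleton_eq_self ?_
      simp [UHP]
    have := hg.boundary_value_eq (f := id) (w₀ := 0) hw differentiableOn_id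
      (by rw [hd]; exact bijOn_id _) (by simp) (by simpa using hreal 0)
      (tendsto_id.mono_left nhdsWithin_le_nhds)
    simp [this]
  set u : ℂ := x + y * I with hu
  have hui : u.im = y := by simp [hu]
  have hur : u.re = x := by simp [hu]
  have hu0 : u ≠ 0 := by
    intro h
    rw [h] at hui
    simp at hui
    linarith
  have hr : 0 < ‖u‖ := norm_pos_iff.2 hu0
  have hπ := Real.pi_pos
  set p : ℝ := u.arg / Real.pi with hp_def
  have harg0 : 0 < u.arg := by
    refine lt_of_le_of_ne (arg_nonneg_iff.2 (by rw [hui]; exact hy.le)) fun h => ?_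
    rw [eq_comm, arg_eq_zero_iff] at h
    linarith [h.2]
  have harg1 : u.arg < Real.pi := arg_lt_pi_iff.2 (Or.inr (by rw [hui]; exact hy.ne'))
  have hp : 0 < p := div_pos harg0 hπ
  have hq : 0 < 1 - p := by
    rw [sub_pos, hp_def, div_lt_one hπ]
    exact harg1
  have hpπ : p * Real.pi = u.arg := div_mul_cancel₀ _ hπ.ne'
  set c : ℝ := ‖u‖ * Real.exp (Real.binEntropy p) with hc_def
  have hc : 0 < c := mul_pos hr (Real.exp_pos _)
  have hpq : p + (1 - p) = 1 := by ring
  have htip : slitMap p (1 - p) c ((1 - p - p) * c : ℝ) = u := by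
    have hne := criticalPoint_ne hp hq hc
    rw [slitMap_eq_exp hne.1 hne.2, slitLog_criticalPoint hp hq hc]
    have hR : p * Real.log (p * c) + (1 - p) * Real.log ((1 - p) * c) = Real.log ‖u‖ := by
      rw [Real.log_mul hp.ne' hc.ne', Real.log_mul hq.ne' hc.ne', hc_def,
        Real.log_mul hr.ne' (Real.exp_pos _).ne', Real.log_exp,
        Real.binEntropy_eq_negMulLog_add_negMulLog_one_sub,
        Real.negMulLog, Real.negMulLog]
      ring
    rw [hR, exp_add, ← ofReal_exp, Real.exp_log hr]
    have hI : I = exp ((Real.pi / 2 : ℝ) * I) := by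
      push_cast
      exact exp_pi_div_two_mul_I.symm
    nth_rewrite 1 [hI]
    rw [mul_left_comm, ← exp_add, ← add_mul, ← ofReal_add]
    have : Real.pi / 2 + (p - (1 - p)) * (Real.pi / 2) = u.arg := by
      rw [← hpπ]
      ring
    rw [this, norm_mul_exp_arg_mul_I]
  have hb := bijOn_slitMap hp hq hpq hc
  have hcont : ContinuousAt (slitMap p (1 - p) c) (((1 - p - p) * c : ℝ) : ℂ) :=
    continuousAt_slitMap hp hq (ofReal_im _).ge
  rw [ContinuousAt, htip] at hcont
  rw [htip] at hb
  rw [hg.boundary_value_eq hw differentiableOn_slitMap hb (tendsto_slitMap_sub hpq) (hreal _)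
    (hcont.mono_left nhdsWithin_le_nhds), norm_real, Real.norm_eq_abs, abs_mul, abs_of_pos hc]
  have hc2 : c ≤ 2 * ‖u‖ := by
    have := Real.exp_le_exp.2 (Real.binEntropy_le_log_two (p := p))
    rw [Real.exp_log two_pos] at this
    rw [hc_def, mul_comm]
    gcongr
  have hsin : |1 - p - p| * ‖u‖ ≤ |x| := by
    have h1 : |Real.pi / 2 - u.arg| ≤ Real.pi / 2 := by
      rw [abs_le]
      constructor <;> linarith
    have h2 := Real.mul_abs_le_abs_sin h1
    rw [Real.sin_pi_div_two_sub] at h2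
    have h3 : 1 - p - p = 2 / Real.pi * (Real.pi / 2 - u.arg) := by
      rw [← hpπ]
      field_simp
      ring
    have h4 : |1 - p - p| ≤ |Real.cos u.arg| := by
      rw [h3, abs_mul, abs_of_pos (by positivity : 0 < 2 / Real.pi)]
      exact h2
    calc |1 - p - p| * ‖u‖ ≤ |Real.cos u.arg| * ‖u‖ := by gcongr
      _ = |x| := by
        rw [cos_arg hu0, abs_div, abs_norm, div_mul_cancel₀ _ hr.ne', hur]
  nlinarith [abs_nonneg (1 - p - p)]

/-- There is a universal constant `C > 0` such that for all
`0 ≤ |x| ≤ y`, the continuous-extension value `w` at the tip `x + iy` of the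
mapping-out function `g` of the segment `[0, x+iy]` satisfies `|w| ≤ C·|x|`. -/
theorem mapping_out_tip_bound :
    ∃ C : ℝ, 0 < C ∧ ∀ x y : ℝ, |x| ≤ y → ∀ g : ℂ → ℂ, ∀ w : ℂ,
      IsMappingOut (segment ℝ (0 : ℂ) (x + y * Complex.I)) g →
      Tendsto g
        (nhdsWithin (x + y * Complex.I)
          (UHP \ segment ℝ (0 : ℂ) (x + y * Complex.I))) (nhds w) →
      ‖w‖ ≤ C * |x| := by
  exact ⟨2, two_pos, fun x y hxy g w hg hw => norm_tip_le hxy hg hw⟩
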